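/- For every permutation w ∈ S_n, the triforce embedding P ↦ P^∇ is a poset isomorphism from the chute move poset PD(w) onto an interval in the chute move poset PD(w^∇), where w^∇ ∈ S_{2n} is defined by w^∇(i) = i for 1 ≤ i ≤ n and w^∇(i) = 2n+1−w(2n+1−i) for n+1 ≤ i ≤ 2n. -/

import Mathlib

open Classical

noncomputable section

/-- 1-based value of a permutation of `Fin n` at a 1-based position `j`. -/
def permVal {n : ℕ} (w : Equiv.Perm (Fin n)) (j : ℕ) : ℕ :=
  if h : 1 ≤ j ∧ j ≤ n then (w ⟨j - 1, by omega⟩ : ℕ) + 1 else 0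

/-- `(i,j)` is an inversion of `w`: `1 ≤ i < j ≤ n` and the (1-based) position of the
value `j` in the one-line notation of `w` precedes that of `i`. -/
def IsInv {n : ℕ} (w : Equiv.Perm (Fin n)) (i j : ℕ) : Prop :=
  1 ≤ i ∧ i < j ∧ j ≤ n ∧ permVal w.symm j < permVal w.symm i

/-- Lehmer form entry at box `(i,j)`: the number of `k ∈ [1, T(i,j)-1]` that do not
appear below box `(i,j)` in column `j`. -/
def lehmer (T : ℕ → ℕ → ℕ) (i j : ℕ) : ℕ :=
  ((Finset.Ico 1 (T i j)).filter fun k => ∀ i', 1 ≤ i' → i' < i → T i' j ≠ k).card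

/-- Incrementing box `(i,j)` of `T` yields `T'`:  with `a = T(i,j)` and `b` the smallest
integer greater than `a` not appearing below `(i,j)` in column `j`, either a pure
increment (if `b` is absent from column `j`) or a trade increment (swap `a` and `b`). -/
def IncrementAt (T T' : ℕ → ℕ → ℕ) (i j : ℕ) : Prop :=
  ∃ b, T i j < b ∧
    (∀ k, T i j < k → k < b → ∃ i', 1 ≤ i' ∧ i' < i ∧ T i' j = k) ∧
    (∀ i', 1 ≤ i' → i' < i → T i' j ≠ b) ∧
    (((∀ i', 1 ≤ i' → T i' j ≠ b) ∧
        T' = fun a c => if a = i ∧ c = j then b else T a c) ∨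
      (∃ i'', i < i'' ∧ T i'' j = b ∧
        T' = fun a c =>
          if a = i ∧ c = j then b else if a = i'' ∧ c = j then T i j else T a c))

/-- `IncBy M T T'`: `T'` is obtained from `T` by incrementing each box of the
multiset `M` (with multiplicity). -/
inductive IncBy : Multiset (ℕ × ℕ) → (ℕ → ℕ → ℕ) → (ℕ → ℕ → ℕ) → Prop
  | nil (T : ℕ → ℕ → ℕ) : IncBy 0 T T
  | cons {M : Multiset (ℕ × ℕ)} {T T' T'' : ℕ → ℕ → ℕ} {i j : ℕ} :
      IncrementAt T T' i j → IncBy M T' T'' → IncBy ((i, j) ::ₘ M) T T''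

/-- Column-injective tableau for `w`: a box has a nonzero entry iff it is an inversion
of `w`, and the nonzero entries in each column are distinct. -/
def ColInj {n : ℕ} (w : Equiv.Perm (Fin n)) (T : ℕ → ℕ → ℕ) : Prop :=
  (∀ i j, T i j ≠ 0 ↔ IsInv w i j) ∧
  ∀ i i' j, 1 ≤ i → i < i' → i' < j → T i j ≠ 0 → T i' j ≠ 0 → T i j ≠ T i' j

/-- The Λ-shape `Λ(i,j,k)` is balanced in `T`. -/
def LBal (T : ℕ → ℕ → ℕ) (i j k : ℕ) : Prop :=
  min (T i j) (T j k) ≤ T i k ∧ T i k ≤ max (T i j) (T j k)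

/-- Every Λ-shape of `Δ_{n-1}` is balanced in `T`. -/
def BalancedTab (n : ℕ) (T : ℕ → ℕ → ℕ) : Prop :=
  ∀ i j k, 1 ≤ i → i < j → j < k → k ≤ n → LBal T i j k

/-- Inversions tableau for `w`: balanced column-injective tableau whose entries in
row `i` are at most `i`. -/
def InvTab {n : ℕ} (w : Equiv.Perm (Fin n)) (T : ℕ → ℕ → ℕ) : Prop :=
  ColInj w T ∧ BalancedTab n T ∧ ∀ i j, T i j ≤ i

/-- The multiset of entries of `T` on `hook(i,k)`. -/
def hookEntries (T : ℕ → ℕ → ℕ) (i k : ℕ) : Multiset ℕ :=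
  (T i k ::ₘ (Finset.Ioo i k).val.map fun r => T r k) +
    (Finset.Ioo i k).val.map fun c => T i c

/-- The median ((k-i)-th smallest of the `2(k-i)-1` entries) of the hook of `(i,k)`. -/
def hookMedian (T : ℕ → ℕ → ℕ) (i k : ℕ) : ℕ :=
  ((hookEntries T i k).sort (· ≤ ·)).getD (k - i - 1) 0

/-! ## Pipe dreams

A pipe dream in the staircase `Δ_n` is encoded by `P : ℕ → ℕ → Bool`, where
`P i j = true` means box `(i,j)` (row `i` from the top, column `j` from the left,
with `1 ≤ i, j` and `i + j ≤ n`) is a cross tile, and `false` means a bump tile;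
boxes on the southeast boundary (`i + j = n + 1`) are elbow tiles. -/

/-- `labels n P i j` is the pair (label of the north edge, label of the east edge) of
the pipes passing through box `(i,j)`:  pipes enter at row `k` on the west side with
label `k` and propagate through cross, bump and elbow tiles. -/
def labels (n : ℕ) (P : ℕ → ℕ → Bool) (i j : ℕ) : ℕ × ℕ :=
  let west := if _h1 : j ≤ 1 then i else (labels n P i (j - 1)).2
  if _h : i + j ≤ n then
    if P i j then ((labels n P (i + 1) j).1, west)
    else (west, (labels n P (i + 1) j).1)
  else (west, west)
termination_by (n + 1 - i) + j
decreasing_by all_goals omega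

def northLabel (n : ℕ) (P : ℕ → ℕ → Bool) (i j : ℕ) : ℕ := (labels n P i j).1

def westLabel (n : ℕ) (P : ℕ → ℕ → Bool) (i j : ℕ) : ℕ :=
  if j ≤ 1 then i else (labels n P i (j - 1)).2

def southLabel (n : ℕ) (P : ℕ → ℕ → Bool) (i j : ℕ) : ℕ := (labels n P (i + 1) j).1

/-- Pipes `p` and `q` cross at box `(i,j)` of `P`. -/
def CrossAt (n : ℕ) (P : ℕ → ℕ → Bool) (i j p q : ℕ) : Prop :=
  1 ≤ i ∧ 1 ≤ j ∧ i + j ≤ n ∧ P i j = true ∧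
    ((westLabel n P i j = p ∧ southLabel n P i j = q) ∨
      (westLabel n P i j = q ∧ southLabel n P i j = p))

/-- `P` is a pipe dream for `w`: crosses lie in the staircase, and reading the pipe
labels along the north side gives the one-line notation of `w`. -/
def IsPD {n : ℕ} (w : Equiv.Perm (Fin n)) (P : ℕ → ℕ → Bool) : Prop :=
  (∀ i j, P i j = true → 1 ≤ i ∧ 1 ≤ j ∧ i + j ≤ n) ∧
    ∀ j, 1 ≤ j → j ≤ n → northLabel n P 1 j = permVal w j

/-- `P` is reduced: no two pipes cross more than once. -/
def Reduced (n : ℕ) (P : ℕ → ℕ → Bool) : Prop :=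
  ∀ p q i j i' j', CrossAt n P i j p q → CrossAt n P i' j' p q → i = i' ∧ j = j'

/-- The set of reduced pipe dreams for `w`. -/
def RPD {n : ℕ} (w : Equiv.Perm (Fin n)) :=
  { P : ℕ → ℕ → Bool // IsPD w P ∧ Reduced n P }

/-- `R` is a rectangle (rows `a < b`, columns `c < d`) in which a chute move of `P`
can take place: `NW(R)=(a,c)` and `SW(R)=(b,c)` are bumps, `SE(R)=(b,d)` is a bump or
elbow, and all other boxes of `R` are crosses. -/
def IsChuteRect (n : ℕ) (P : ℕ → ℕ → Bool) (a b c d : ℕ) : Prop :=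
  1 ≤ a ∧ a < b ∧ 1 ≤ c ∧ c < d ∧ b + d ≤ n + 1 ∧
    P a c = false ∧ P b c = false ∧ P b d = false ∧
    ∀ i j, a ≤ i → i ≤ b → c ≤ j → j ≤ d →
      ¬(i = a ∧ j = c) → ¬(i = b ∧ j = c) → ¬(i = b ∧ j = d) → P i j = true

/-- The result of the chute move in the rectangle with corners `(a,c)`, `(b,d)`:
the bump at `SW=(b,c)` becomes a cross and the cross at `NE=(a,d)` becomes a bump. -/
def chuteResult (P : ℕ → ℕ → Bool) (a b c d : ℕ) : ℕ → ℕ → Bool :=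
  fun i j => if i = b ∧ j = c then true else if i = a ∧ j = d then false else P i j

/-- `P'` is obtained from `P` by a single chute move. -/
def ChuteStep (n : ℕ) (P P' : ℕ → ℕ → Bool) : Prop :=
  ∃ a b c d, IsChuteRect n P a b c d ∧ P' = chuteResult P a b c d

/-- The chute move order on `RPD w`: `P ≤ Q` iff `Q` is obtained from `P`
by a sequence of chute moves. -/
def chuteLE {n : ℕ} (w : Equiv.Perm (Fin n)) (P Q : RPD w) : Prop :=
  Relation.ReflTransGen (fun X Y : RPD w => ChuteStep n X.1 Y.1) P Q

/-- `theta n P p q` is the index of the row in which pipes `p` and `q` cross in `P`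
(`0` if they do not cross).  For `P ∈ PD(w)` reduced, `theta n P` is the inversions
tableau `Θ(P)`. -/
def theta (n : ℕ) (P : ℕ → ℕ → Bool) (p q : ℕ) : ℕ :=
  if h : ∃ rc : ℕ × ℕ, CrossAt n P rc.1 rc.2 p q then (Classical.choose h).1 else 0

/-- The Lehmer tableau `Φ(P) = Λ(Θ(P))` of a pipe dream. -/
def phi (n : ℕ) (P : ℕ → ℕ → Bool) (i j : ℕ) : ℕ := lehmer (theta n P) i j

/-- Cover relation of the chute move order. -/
def chuteCovBy {n : ℕ} (w : Equiv.Perm (Fin n)) (P Q : RPD w) : Prop :=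
  chuteLE w P Q ∧ P ≠ Q ∧ ∀ R, chuteLE w P R → chuteLE w R Q → R = P ∨ R = Q

/-- The interval `[P, Q]` in the chute move order. -/
def chuteIcc {n : ℕ} (w : Equiv.Perm (Fin n)) (P Q : RPD w) : Set (RPD w) :=
  { R | chuteLE w P R ∧ chuteLE w R Q }

/-- A chain in the chute move order. -/
def chuteChain {n : ℕ} (w : Equiv.Perm (Fin n)) (C : Set (RPD w)) : Prop :=
  ∀ x ∈ C, ∀ y ∈ C, chuteLE w x y ∨ chuteLE w y x

/-- `[P,Q]` is a polygon: an interval of cardinality at least 4 that is the union of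
two chains whose intersection is `{P, Q}`. -/
def IsPolygon {n : ℕ} (w : Equiv.Perm (Fin n)) (P Q : RPD w) : Prop :=
  chuteLE w P Q ∧ 4 ≤ (chuteIcc w P Q).ncard ∧
    ∃ C₁ C₂ : Set (RPD w), chuteChain w C₁ ∧ chuteChain w C₂ ∧
      C₁ ∪ C₂ = chuteIcc w P Q ∧ C₁ ∩ C₂ = {P, Q}

/-- `m` is the meet (greatest lower bound) of `P` and `Q` in the chute move order. -/
def IsMeetOf {n : ℕ} (w : Equiv.Perm (Fin n)) (m P Q : RPD w) : Prop :=
  chuteLE w m P ∧ chuteLE w m Q ∧ ∀ r, chuteLE w r P → chuteLE w r Q → chuteLE w r m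

/-- `s` is the join (least upper bound) of `P` and `Q` in the chute move order. -/
def IsJoinOf {n : ℕ} (w : Equiv.Perm (Fin n)) (s P Q : RPD w) : Prop :=
  chuteLE w P s ∧ chuteLE w Q s ∧ ∀ r, chuteLE w P r → chuteLE w Q r → chuteLE w s r

/-- The triforce pipe dream `P^∇` in the staircase `Δ_{2n}`: box `(n+1-j, n+1-i)` gets
the tile of box `(i,j)` of `P` (elbows of `P` become bumps), and all other boxes are
bumps (or boundary elbows). -/
def triPD (n : ℕ) (P : ℕ → ℕ → Bool) : ℕ → ℕ → Bool :=
  fun a b => if 1 ≤ a ∧ 1 ≤ b ∧ a + b ≤ 2 * n then P (n + 1 - b) (n + 1 - a) else false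

/-- All crosses of `P` lie in the staircase `Δ_n`. -/
def CrossesIn (n : ℕ) (P : ℕ → ℕ → Bool) : Prop :=
  ∀ i j, P i j = true → 1 ≤ i ∧ 1 ≤ j ∧ i + j ≤ n

/-- `N i j` and `V i j` are the labels of the north and east edges of box `(i,j)`, with `V i 0`
the label of the west edge of `(i,1)`. -/
structure IsLabeling (n : ℕ) (P : ℕ → ℕ → Bool) (N V : ℕ → ℕ → ℕ) : Prop where
  base : ∀ i, 1 ≤ i → i ≤ n → V i 0 = i
  cross_north : ∀ i j, P i j = true → N i j = N (i + 1) j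
  cross_east : ∀ i j, P i j = true → V i j = V i (j - 1)
  bump_north : ∀ i j, 1 ≤ i → 1 ≤ j → i + j ≤ n + 1 → P i j = false → N i j = V i (j - 1)
  bump_east : ∀ i j, 1 ≤ i → 1 ≤ j → i + j ≤ n → P i j = false → V i j = N (i + 1) j

/-- No two crosses carry the same unordered pair of labels. -/
def CrossesDistinct (P : ℕ → ℕ → Bool) (N V : ℕ → ℕ → ℕ) : Prop :=
  ∀ i j i' j', P i j = true → P i' j' = true →
    (V i (j - 1) = V i' (j' - 1) ∧ N (i + 1) j = N (i' + 1) j' ∨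
      V i (j - 1) = N (i' + 1) j' ∧ N (i + 1) j = V i' (j' - 1)) → i = i' ∧ j = j'

def eastLabel (n : ℕ) (P : ℕ → ℕ → Bool) (i j : ℕ) : ℕ :=
  if j = 0 then i else (labels n P i j).2

lemma westLabel_eq (n : ℕ) (P : ℕ → ℕ → Bool) (i j : ℕ) :
    westLabel n P i j = eastLabel n P i (j - 1) := by
  unfold westLabel eastLabel
  by_cases h : j ≤ 1
  · simp [h]
  · rw [if_neg h, if_neg (by omega)]

lemma labels_eq (n : ℕ) (P : ℕ → ℕ → Bool) (i j : ℕ) :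
    labels n P i j =
      if i + j ≤ n then
        if P i j then (northLabel n P (i + 1) j, eastLabel n P i (j - 1))
        else (eastLabel n P i (j - 1), northLabel n P (i + 1) j)
      else (eastLabel n P i (j - 1), eastLabel n P i (j - 1)) := by
  rw [← westLabel_eq]
  conv_lhs => unfold labels
  simp only [dite_eq_ite]
  rfl

lemma isLabeling_labels {n : ℕ} {P : ℕ → ℕ → Bool} (hP : CrossesIn n P) :
    IsLabeling n P (northLabel n P) (eastLabel n P) where
  base i _ _ := by simp [eastLabel]
  cross_north i j h := by
    have := hP i j h
    conv_lhs => rw [northLabel, labels_eq]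
    simp [h, this.2.2]
  cross_east i j h := by
    have := hP i j h
    conv_lhs => rw [eastLabel, labels_eq]
    simp [h, this.2.2, show j ≠ 0 by omega]
  bump_north i j _ _ _ h := by
    conv_lhs => rw [northLabel, labels_eq]
    simp only [h]
    split_ifs <;> simp_all
  bump_east i j h1 h2 h3 h := by
    conv_lhs => rw [eastLabel, labels_eq]
    simp [h, h3, show j ≠ 0 by omega]

lemma IsLabeling.labels_unique {n : ℕ} {P : ℕ → ℕ → Bool} (hP : CrossesIn n P)
    {N V N' V' : ℕ → ℕ → ℕ} (h : IsLabeling n P N V) (h' : IsLabeling n P N' V') :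
    ∀ i j, 1 ≤ i → (1 ≤ j → i + j ≤ n + 1 → N i j = N' i j) ∧ (i + j ≤ n → V i j = V' i j) := by
  suffices H : ∀ m i j, (n + 1 - i) + j ≤ m → 1 ≤ i → (1 ≤ j → i + j ≤ n + 1 → N i j = N' i j) ∧
      (i + j ≤ n → V i j = V' i j) from fun i j => H _ i j le_rfl
  intro m
  induction m with
  | zero => exact fun i j _ _ => ⟨fun _ _ => by omega, fun _ => by omega⟩
  | succ m ih =>
    intro i j hm hi
    obtain rfl | hj := Nat.eq_zero_or_pos j
    · exact ⟨fun _ => by omega, fun _ => by rw [h.base i hi (by omega), h'.base i hi (by omega)]⟩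
    · have hV : i + j ≤ n + 1 → V i (j - 1) = V' i (j - 1) :=
        fun _ => (ih i (j - 1) (by omega) hi).2 (by omega)
      have hN : i + j ≤ n → N (i + 1) j = N' (i + 1) j :=
        fun _ => (ih (i + 1) j (by omega) (by omega)).1 hj (by omega)
      cases hb : P i j with
      | true =>
        have := hP i j hb
        rw [h.cross_north i j hb, h'.cross_north i j hb, h.cross_east i j hb,
          h'.cross_east i j hb]
        exact ⟨fun _ _ => hN (by omega), fun _ => hV (by omega)⟩
      | false =>
        constructor
        · intro _ hij
          rw [h.bump_north i j hi hj hij hb, h'.bump_north i j hi hj hij hb, hV hij]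
        · intro hij
          rw [h.bump_east i j hi hj hij hb, h'.bump_east i j hi hj hij hb, hN hij]

lemma isPD_and_reduced_iff {n : ℕ} (w : Equiv.Perm (Fin n)) {P : ℕ → ℕ → Bool}
    {N V : ℕ → ℕ → ℕ} (hP : CrossesIn n P) (h : IsLabeling n P N V) :
    IsPD w P ∧ Reduced n P ↔
      (∀ j, 1 ≤ j → j ≤ n → N 1 j = permVal w j) ∧ CrossesDistinct P N V := by
  have hu := h.labels_unique hP (isLabeling_labels hP)
  have hW : ∀ i j, P i j = true → westLabel n P i j = V i (j - 1) := fun i j hij => by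
    have := hP i j hij
    rw [westLabel_eq, (hu i (j - 1) (by omega)).2 (by omega)]
  have hS : ∀ i j, P i j = true → southLabel n P i j = N (i + 1) j := fun i j hij => by
    have := hP i j hij
    rw [(hu (i + 1) j (by omega)).1 (by omega) (by omega)]
    rfl
  refine and_congr ⟨fun H j h1 h2 => ?_, fun H => ⟨hP, fun j h1 h2 => ?_⟩⟩ ⟨fun H => ?_, fun H => ?_⟩
  · rw [(hu 1 j le_rfl).1 h1 (by omega), H.2 j h1 h2]
  · rw [← (hu 1 j le_rfl).1 h1 (by omega), H j h1 h2]
  · intro i j i' j' hb hb' hh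
    have h1 := hP i j hb
    have h2 := hP i' j' hb'
    refine H (V i (j - 1)) (N (i + 1) j) i j i' j' ⟨h1.1, h1.2.1, h1.2.2, hb, ?_⟩
      ⟨h2.1, h2.2.1, h2.2.2, hb', ?_⟩
    · rw [hW i j hb, hS i j hb]; tauto
    · rw [hW i' j' hb', hS i' j' hb']
      rcases hh with hh | hh
      · exact Or.inl ⟨hh.1.symm, hh.2.symm⟩
      · exact Or.inr ⟨hh.2.symm, hh.1.symm⟩
  · rintro p q i j i' j' ⟨_, _, _, hb, hh⟩ ⟨_, _, _, hb', hh'⟩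
    rw [hW i j hb, hS i j hb] at hh
    rw [hW i' j' hb', hS i' j' hb'] at hh'
    apply H i j i' j' hb hb'
    rcases hh with ⟨rfl, rfl⟩ | ⟨rfl, rfl⟩ <;> rcases hh' with ⟨e1, e2⟩ | ⟨e1, e2⟩ <;> simp [e1, e2]

lemma RPD.crossesIn {n : ℕ} {w : Equiv.Perm (Fin n)} (P : RPD w) : CrossesIn n P.1 := P.2.1.1

lemma RPD.exists_labeling {n : ℕ} {w : Equiv.Perm (Fin n)} (P : RPD w) :
    ∃ N V, IsLabeling n P.1 N V ∧ (∀ j, 1 ≤ j → j ≤ n → N 1 j = permVal w j) ∧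
      CrossesDistinct P.1 N V :=
  ⟨_, _, isLabeling_labels P.crossesIn,
    (isPD_and_reduced_iff w P.crossesIn (isLabeling_labels P.crossesIn)).1 P.2⟩

lemma IsLabeling.mem_range {n : ℕ} {P : ℕ → ℕ → Bool} (hP : CrossesIn n P)
    {N V : ℕ → ℕ → ℕ} (h : IsLabeling n P N V) :
    ∀ i j, 1 ≤ i → (1 ≤ j → i + j ≤ n + 1 → 1 ≤ N i j ∧ N i j ≤ n) ∧
      (i + j ≤ n → 1 ≤ V i j ∧ V i j ≤ n) := by
  suffices H : ∀ m i j, (n + 1 - i) + j ≤ m → 1 ≤ i →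
      (1 ≤ j → i + j ≤ n + 1 → 1 ≤ N i j ∧ N i j ≤ n) ∧
      (i + j ≤ n → 1 ≤ V i j ∧ V i j ≤ n) from fun i j => H _ i j le_rfl
  intro m
  induction m with
  | zero => exact fun i j _ _ => ⟨fun _ _ => by omega, fun _ => by omega⟩
  | succ m ih =>
    intro i j hm hi
    obtain rfl | hj := Nat.eq_zero_or_pos j
    · exact ⟨fun _ => by omega, fun _ => by rw [h.base i hi (by omega)]; omega⟩
    · have hV := (ih i (j - 1) (by omega) hi).2
      have hN : i + j ≤ n → 1 ≤ N (i + 1) j ∧ N (i + 1) j ≤ n :=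
        fun _ => (ih (i + 1) j (by omega) (by omega)).1 hj (by omega)
      cases hb : P i j with
      | true =>
        have := hP i j hb
        rw [h.cross_north i j hb, h.cross_east i j hb]
        exact ⟨fun _ _ => hN (by omega), fun _ => hV (by omega)⟩
      | false =>
        constructor
        · intro _ hij
          rw [h.bump_north i j hi hj hij hb]
          exact hV (by omega)
        · intro hij
          rw [h.bump_east i j hi hj hij hb]
          exact hN hij

lemma permVal_mem {n : ℕ} (w : Equiv.Perm (Fin n)) {j : ℕ} (h1 : 1 ≤ j) (h2 : j ≤ n) :
    1 ≤ permVal w j ∧ permVal w j ≤ n := by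
  rw [permVal, dif_pos ⟨h1, h2⟩]
  have := (w ⟨j - 1, by omega⟩).2
  omega

lemma permVal_symm_permVal {n : ℕ} (w : Equiv.Perm (Fin n)) {j : ℕ} (h1 : 1 ≤ j) (h2 : j ≤ n) :
    permVal w.symm (permVal w j) = j := by
  have h := permVal_mem w h1 h2
  rw [permVal, dif_pos h]
  have : (⟨permVal w j - 1, by omega⟩ : Fin n) = w ⟨j - 1, by omega⟩ := by
    ext
    simp [permVal, h1, h2]
  rw [this]
  simp
  omega

lemma permVal_injOn {n : ℕ} (w : Equiv.Perm (Fin n)) {i j : ℕ} (hi1 : 1 ≤ i) (hi2 : i ≤ n)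
    (hj1 : 1 ≤ j) (hj2 : j ≤ n) (h : permVal w i = permVal w j) : i = j := by
  rw [← permVal_symm_permVal w hi1 hi2, h, permVal_symm_permVal w hj1 hj2]

def transposePD (P : ℕ → ℕ → Bool) : ℕ → ℕ → Bool := fun i j => P j i

lemma transposePD_mem {n : ℕ} {w : Equiv.Perm (Fin n)} (P : RPD w) :
    IsPD w.symm (transposePD P.1) ∧ Reduced n (transposePD P.1) := by
  obtain ⟨N, V, hL, hw, hR⟩ := P.exists_labeling
  have hP := P.crossesIn
  have hm := hL.mem_range hP
  have hT : CrossesIn n (transposePD P.1) := fun i j h => by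
    have := hP j i h
    omega
  have hLT : IsLabeling n (transposePD P.1) (fun i j => permVal w.symm (V j (i - 1)))
      (fun i j => permVal w.symm (N (j + 1) i)) := by
    refine ⟨fun i h1 h2 => ?_, fun i j h => ?_, fun i j h => ?_, fun i j h1 h2 h3 h => ?_,
      fun i j h1 h2 h3 h => ?_⟩
    · simp only [zero_add]
      rw [hw i h1 h2, permVal_symm_permVal w h1 h2]
    · simp only [Nat.add_sub_cancel]
      rw [hL.cross_east j i h]
    · have := hP j i h
      rw [Nat.sub_add_cancel (by omega), hL.cross_north j i h]
    · rw [Nat.sub_add_cancel h2, hL.bump_north j i h2 h1 (by omega) h]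
    · simp only [Nat.add_sub_cancel]
      rw [hL.bump_east j i h2 h1 (by omega) h]
  refine (isPD_and_reduced_iff w.symm hT hLT).2 ⟨fun j h1 h2 => ?_, ?_⟩
  · simp only [Nat.sub_self]
    rw [hL.base j h1 h2]
  · intro i j i' j' hb hb' hh
    have h1 := hP j i hb
    have h2 := hP j' i' hb'
    simp only [Nat.add_sub_cancel] at hh
    rw [Nat.sub_add_cancel h1.1, Nat.sub_add_cancel h2.1, hL.cross_north j i hb,
      hL.cross_north j' i' hb', hL.cross_east j i hb, hL.cross_east j' i' hb'] at hh
    have m1 := (hm (j + 1) i (by omega)).1 (by omega) (by omega)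
    have m2 := (hm (j' + 1) i' (by omega)).1 (by omega) (by omega)
    have m3 := (hm j (i - 1) (by omega)).2 (by omega)
    have m4 := (hm j' (i' - 1) (by omega)).2 (by omega)
    refine (hR j i j' i' hb hb' ?_).symm
    rcases hh with ⟨e1, e2⟩ | ⟨e1, e2⟩
    · exact Or.inl ⟨permVal_injOn _ m3.1 m3.2 m4.1 m4.2 e2, permVal_injOn _ m1.1 m1.2 m2.1 m2.2 e1⟩
    · exact Or.inr ⟨permVal_injOn _ m3.1 m3.2 m2.1 m2.2 e2, permVal_injOn _ m1.1 m1.2 m4.1 m4.2 e1⟩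

lemma triPD_eq_true {n : ℕ} {P : ℕ → ℕ → Bool} (hP : CrossesIn n P) {a b : ℕ} :
    triPD n P a b = true ↔
      a ≤ n ∧ b ≤ n ∧ n + 2 ≤ a + b ∧ P (n + 1 - b) (n + 1 - a) = true := by
  unfold triPD
  constructor
  · intro h
    split_ifs at h with hab
    have := hP _ _ h
    exact ⟨by omega, by omega, by omega, h⟩
  · rintro ⟨h1, h2, h3, h4⟩
    rw [if_pos (by omega), h4]

lemma crossesIn_triPD {n : ℕ} {P : ℕ → ℕ → Bool} (hP : CrossesIn n P) :
    CrossesIn (2 * n) (triPD n P) := fun i j h => by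
  have := (triPD_eq_true hP).1 h
  omega

def triNorth (n : ℕ) (N V : ℕ → ℕ → ℕ) (a b : ℕ) : ℕ :=
  if n + 1 ≤ a ∨ a + b ≤ n + 1 then a + b - 1
  else if b ≤ n then 2 * n + 1 - V (n + 1 - b) (n + 1 - a)
  else 2 * n + 1 - N 1 (2 * n + 2 - a - b)

def triEast (n : ℕ) (N : ℕ → ℕ → ℕ) (a b : ℕ) : ℕ :=
  if n + 1 ≤ a ∨ a + b ≤ n then a + b
  else if b ≤ n then 2 * n + 1 - N (n + 1 - b) (n + 1 - a)
  else 2 * n + 1 - N 1 (2 * n + 1 - a - b)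

lemma isLabeling_triPD {n : ℕ} {P : ℕ → ℕ → Bool} (hP : CrossesIn n P) {N V : ℕ → ℕ → ℕ}
    (h : IsLabeling n P N V) :
    IsLabeling (2 * n) (triPD n P) (triNorth n N V) (triEast n N) := by
  have hbump : ∀ a b, a ≤ n → b ≤ n → n + 1 ≤ a + b → triPD n P a b = false →
      P (n + 1 - b) (n + 1 - a) = false := fun a b h1 h2 h3 hb => by
    by_contra hc
    rw [Bool.not_eq_false] at hc
    have := hP _ _ hc
    rw [(triPD_eq_true hP).2 ⟨h1, h2, by omega, hc⟩] at hb
    cases hb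
  refine ⟨fun a h1 h2 => ?_, fun a b hb => ?_, fun a b hb => ?_, fun a b h1 h2 h3 hb => ?_,
    fun a b h1 h2 h3 hb => ?_⟩
  · unfold triEast
    split_ifs <;> omega
  · obtain ⟨h1, h2, h3, hc⟩ := (triPD_eq_true hP).1 hb
    have := h.cross_east _ _ hc
    unfold triNorth
    rw [if_neg (by omega), if_pos h2, this]
    by_cases ha : a = n
    · rw [if_pos (by omega), ha, show n + 1 - n - 1 = 0 by omega,
        h.base (n + 1 - b) (by omega) (by omega)]
      omega
    · rw [if_neg (by omega), if_pos h2]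
      congr 2
  · obtain ⟨h1, h2, h3, hc⟩ := (triPD_eq_true hP).1 hb
    have := h.cross_north _ _ hc
    unfold triEast
    rw [if_neg (by omega), if_pos h2, this, if_neg (by omega), if_pos (by omega)]
    congr 2
    omega
  · unfold triNorth triEast
    by_cases c1 : n + 1 ≤ a ∨ a + b ≤ n + 1
    · rw [if_pos c1, if_pos (by omega)]
      omega
    · rw [if_neg c1]
      by_cases c2 : b ≤ n
      · rw [if_pos c2, if_neg (by omega), if_pos (by omega),
          h.bump_east _ _ (by omega) (by omega) (by omega)
            (hbump a b (by omega) c2 (by omega) hb)]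
        congr 2
        omega
      · rw [if_neg c2, if_neg (by omega)]
        by_cases c3 : b - 1 ≤ n
        · rw [if_pos c3]
          congr 2 <;> omega
        · rw [if_neg c3]
          congr 2
          omega
  · unfold triNorth triEast
    by_cases c1 : n + 1 ≤ a ∨ a + b ≤ n
    · rw [if_pos c1, if_pos (by omega)]
      omega
    · rw [if_neg c1]
      by_cases c2 : b ≤ n
      · rw [if_pos c2, h.bump_north _ _ (by omega) (by omega) (by omega)
          (hbump a b (by omega) c2 (by omega) hb)]
        by_cases c3 : n + 1 ≤ a + 1
        · rw [if_pos (by omega), show n + 1 - a - 1 = 0 by omega,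
            h.base (n + 1 - b) (by omega) (by omega)]
          omega
        · rw [if_neg (by omega), if_pos c2]
          congr 2
      · rw [if_neg c2, if_neg (by omega), if_neg c2]
        congr 2
        omega

lemma crossesDistinct_triPD_iff {n : ℕ} {P : ℕ → ℕ → Bool} (hP : CrossesIn n P)
    {N V : ℕ → ℕ → ℕ} (h : IsLabeling n P N V) :
    CrossesDistinct (triPD n P) (triNorth n N V) (triEast n N) ↔ CrossesDistinct P N V := by
  have hE : ∀ i j, P i j = true →
      triEast n N (n + 1 - j) (n + 1 - i - 1) = 2 * n + 1 - N (i + 1) j := fun i j hb => by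
    have := hP i j hb
    rw [triEast, if_neg (by omega), if_pos (by omega)]
    congr 2 <;> omega
  have hN : ∀ i j, P i j = true →
      triNorth n N V (n + 1 - j + 1) (n + 1 - i) = 2 * n + 1 - V i (j - 1) := fun i j hb => by
    have := hP i j hb
    by_cases hj : j = 1
    · rw [triNorth, if_pos (by omega), hj, Nat.sub_self, h.base i (by omega) (by omega)]
      omega
    · rw [triNorth, if_neg (by omega), if_pos (by omega)]
      congr 2 <;> omega
  have hm := h.mem_range hP
  constructor
  · intro H i j i' j' hb hb' hh
    have h1 := hP i j hb
    have h2 := hP i' j' hb'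
    have := H (n + 1 - j) (n + 1 - i) (n + 1 - j') (n + 1 - i')
      ((triPD_eq_true hP).2 ⟨by omega, by omega, by omega, by
        rwa [show n + 1 - (n + 1 - i) = i by omega, show n + 1 - (n + 1 - j) = j by omega]⟩)
      ((triPD_eq_true hP).2 ⟨by omega, by omega, by omega, by
        rwa [show n + 1 - (n + 1 - i') = i' by omega, show n + 1 - (n + 1 - j') = j' by omega]⟩)
      (by rw [hE i j hb, hE i' j' hb', hN i j hb, hN i' j' hb']; omega)
    omega
  · intro H a b a' b' hb hb' hh
    obtain ⟨h1, h2, h3, hc⟩ := (triPD_eq_true hP).1 hb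
    obtain ⟨h1', h2', h3', hc'⟩ := (triPD_eq_true hP).1 hb'
    have e1 := hE _ _ hc
    have e2 := hN _ _ hc
    have e3 := hE _ _ hc'
    have e4 := hN _ _ hc'
    rw [show n + 1 - (n + 1 - a) = a by omega, show n + 1 - (n + 1 - b) = b by omega] at e1 e2
    rw [show n + 1 - (n + 1 - a') = a' by omega, show n + 1 - (n + 1 - b') = b' by omega] at e3 e4
    have q := hP _ _ hc
    have q' := hP _ _ hc'
    have m1 := (hm (n + 1 - b + 1) (n + 1 - a) (by omega)).1 (by omega) (by omega)
    have m2 := (hm (n + 1 - b' + 1) (n + 1 - a') (by omega)).1 (by omega) (by omega)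
    have m3 := (hm (n + 1 - b) (n + 1 - a - 1) (by omega)).2 (by omega)
    have m4 := (hm (n + 1 - b') (n + 1 - a' - 1) (by omega)).2 (by omega)
    have := H _ _ _ _ hc hc' (by omega)
    omega

lemma triPD_mem_iff {n : ℕ} (w : Equiv.Perm (Fin n)) (wtri : Equiv.Perm (Fin (2 * n)))
    (hwtri : ∀ i, 1 ≤ i → i ≤ 2 * n →
      permVal wtri i = if i ≤ n then i else 2 * n + 1 - permVal w (2 * n + 1 - i))
    {P : ℕ → ℕ → Bool} (hP : CrossesIn n P) :
    IsPD wtri (triPD n P) ∧ Reduced (2 * n) (triPD n P) ↔ IsPD w P ∧ Reduced n P := by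
  have h := isLabeling_labels hP
  rw [isPD_and_reduced_iff w hP h, isPD_and_reduced_iff wtri (crossesIn_triPD hP)
    (isLabeling_triPD hP h), crossesDistinct_triPD_iff hP h]
  refine and_congr_left fun _ => ⟨fun H j h1 h2 => ?_, fun H b h1 h2 => ?_⟩
  · have e := H (2 * n + 1 - j) (by omega) (by omega)
    have m1 := (h.mem_range hP 1 j le_rfl).1 h1 (by omega)
    have m2 := permVal_mem w h1 h2
    rw [hwtri _ (by omega) (by omega), if_neg (by omega),
      show 2 * n + 1 - (2 * n + 1 - j) = j by omega, triNorth] at e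
    split_ifs at e with c1 c2
    · have hn : j = n ∧ n = 0 := by omega
      omega
    · omega
    · rw [show 2 * n + 2 - 1 - (2 * n + 1 - j) = j by omega] at e
      omega
  · rw [hwtri b h1 h2]
    by_cases hb : b ≤ n
    · rw [if_pos hb, triNorth, if_pos (by omega)]
      omega
    · rw [if_neg hb, triNorth, if_neg (by omega), if_neg hb, ← H _ (by omega) (by omega)]
      congr 2

lemma isChuteRect_triPD_iff {n : ℕ} {P : ℕ → ℕ → Bool} {a b c d : ℕ} (ha : 1 ≤ a)
    (hc : 1 ≤ c) (hb : b ≤ n) (hd : d ≤ n) (hac : n + 1 ≤ a + c) :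
    IsChuteRect (2 * n) (triPD n P) a b c d ↔
      IsChuteRect n P (n + 1 - d) (n + 1 - c) (n + 1 - b) (n + 1 - a) := by
  have key : ∀ a' b', 1 ≤ a' → 1 ≤ b' → a' ≤ n → b' ≤ n →
      triPD n P a' b' = P (n + 1 - b') (n + 1 - a') := fun a' b' _ _ _ _ => by
    rw [triPD, if_pos (by omega)]
  constructor
  · rintro ⟨h1, h2, h3, h4, h5, h6, h7, h8, h9⟩
    rw [key _ _ (by omega) (by omega) (by omega) (by omega)] at h6 h7 h8
    refine ⟨by omega, by omega, by omega, by omega, by omega, h8, h7, h6, ?_⟩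
    intro i j q1 q2 q3 q4 q5 q6 q7
    have := h9 (n + 1 - j) (n + 1 - i) (by omega) (by omega) (by omega) (by omega) (by omega)
      (by omega) (by omega)
    rw [key _ _ (by omega) (by omega) (by omega) (by omega)] at this
    rwa [show n + 1 - (n + 1 - i) = i by omega, show n + 1 - (n + 1 - j) = j by omega] at this
  · rintro ⟨h1, h2, h3, h4, h5, h6, h7, h8, h9⟩
    refine ⟨by omega, by omega, by omega, by omega, by omega, ?_, ?_, ?_, ?_⟩
    · rwa [key _ _ (by omega) (by omega) (by omega) (by omega)]
    · rwa [key _ _ (by omega) (by omega) (by omega) (by omega)]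
    · rwa [key _ _ (by omega) (by omega) (by omega) (by omega)]
    · intro i j q1 q2 q3 q4 q5 q6 q7
      rw [key _ _ (by omega) (by omega) (by omega) (by omega)]
      exact h9 _ _ (by omega) (by omega) (by omega) (by omega) (by omega) (by omega) (by omega)

lemma triPD_chuteResult {n : ℕ} (P : ℕ → ℕ → Bool) {a b c d : ℕ} (hab : a < b) (hcd : c < d)
    (ha : 1 ≤ a) (hc : 1 ≤ c) (hb : b ≤ n) (hd : d ≤ n) :
    triPD n (chuteResult P (n + 1 - d) (n + 1 - c) (n + 1 - b) (n + 1 - a)) =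
      chuteResult (triPD n P) a b c d := by
  funext i j
  simp only [triPD, chuteResult]
  by_cases h : 1 ≤ i ∧ 1 ≤ j ∧ i + j ≤ 2 * n
  · rw [if_pos h, if_pos h]
    by_cases h1 : i = b ∧ j = c
    · rw [if_pos h1, if_pos (by omega)]
    · rw [if_neg h1, if_neg (by omega)]
      by_cases h2 : i = a ∧ j = d
      · rw [if_pos h2, if_pos (by omega)]
      · rw [if_neg h2, if_neg (by omega)]
  · rw [if_neg h, if_neg h, if_neg (by omega), if_neg (by omega)]

lemma triPD_injective {n : ℕ} {P Q : ℕ → ℕ → Bool} (hP : CrossesIn n P) (hQ : CrossesIn n Q)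
    (h : triPD n P = triPD n Q) : P = Q := by
  have key : ∀ R : ℕ → ℕ → Bool, ∀ i j, 1 ≤ i → 1 ≤ j → i + j ≤ n →
      triPD n R (n + 1 - j) (n + 1 - i) = R i j := fun R i j _ _ _ => by
    rw [triPD, if_pos (by omega)]
    congr 1 <;> omega
  funext i j
  by_cases hij : 1 ≤ i ∧ 1 ≤ j ∧ i + j ≤ n
  · rw [← key P i j hij.1 hij.2.1 hij.2.2, h, key Q i j hij.1 hij.2.1 hij.2.2]
  · rw [Bool.eq_false_iff.2 fun hc => hij (hP i j hc), Bool.eq_false_iff.2 fun hc => hij (hQ i j hc)]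

lemma chuteStep_triPD {n : ℕ} {P Q : ℕ → ℕ → Bool} (h : ChuteStep n P Q) :
    ChuteStep (2 * n) (triPD n P) (triPD n Q) := by
  obtain ⟨a, b, c, d, hR, rfl⟩ := h
  have ⟨h1, h2, h3, h4, h5, _⟩ := hR
  refine ⟨n + 1 - d, n + 1 - c, n + 1 - b, n + 1 - a,
    (isChuteRect_triPD_iff (by omega) (by omega) (by omega) (by omega) (by omega)).2 ?_, ?_⟩
  · convert hR using 1 <;> omega
  · rw [← triPD_chuteResult P (by omega) (by omega) (by omega) (by omega) (by omega) (by omega)]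
    congr 2 <;> omega

lemma exists_chuteStep_of_triPD {n : ℕ} {P γ : ℕ → ℕ → Bool} (hP : CrossesIn n P)
    (h : ChuteStep (2 * n) (triPD n P) γ) (hγ : ∀ i j, γ i j = true → i ≤ n) :
    ∃ Q, CrossesIn n Q ∧ triPD n Q = γ ∧ ChuteStep n P Q := by
  obtain ⟨a, b, c, d, hR, rfl⟩ := h
  have ⟨h1, h2, h3, h4, h5, h6, h7, h8, h9⟩ := hR
  have hb : b ≤ n := hγ b c (by simp [chuteResult])
  have had := (triPD_eq_true hP).1
    (h9 a d le_rfl h2.le h4.le le_rfl (by omega) (by omega) (by omega))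
  have hac := (triPD_eq_true hP).1
    (h9 a (c + 1) le_rfl h2.le (by omega) (by omega) (by omega) (by omega) (by omega))
  have hR' := (isChuteRect_triPD_iff h1 h3 hb had.2.1 (by omega)).1 hR
  refine ⟨_, ?_, triPD_chuteResult P h2 h4 h1 h3 hb had.2.1, _, _, _, _, hR', rfl⟩
  intro i j hij
  unfold chuteResult at hij
  split_ifs at hij with q1
  · omega
  · exact hP i j hij

lemma ChuteStep.rows_le {m n : ℕ} {P Q : ℕ → ℕ → Bool} (h : ChuteStep m P Q)
    (hQ : ∀ i j, Q i j = true → i ≤ n) : ∀ i j, P i j = true → i ≤ n := by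
  obtain ⟨a, b, c, d, hR, rfl⟩ := h
  intro i j hij
  by_cases h1 : i = a ∧ j = d
  · have := hQ b c (by simp [chuteResult])
    have := hR.2.1
    omega
  · refine hQ i j ?_
    unfold chuteResult
    rw [if_neg h1, hij]
    simp

/-- An inverse chute move in the two-row rectangle with corners `(a,c)` and `(a+1,d)`. -/
def unchute (P : ℕ → ℕ → Bool) (a c d : ℕ) : ℕ → ℕ → Bool :=
  fun i j => if i = a + 1 ∧ j = c then false else if i = a ∧ j = d then true else P i j

/-- The position in `P` of the pair of pipes crossing at box `(i,j)` of `unchute P a c d`. -/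
def unchuteBox (a c d i j : ℕ) : ℕ × ℕ :=
  if i = a ∧ j = d then (a + 1, c)
  else if i = a ∧ c < j ∧ j < d then (a + 1, j)
  else if i = a + 1 ∧ c < j ∧ j < d then (a, j)
  else (i, j)

lemma IsLabeling.two_row_strip {n : ℕ} {P : ℕ → ℕ → Bool} {N V : ℕ → ℕ → ℕ}
    (h : IsLabeling n P N V) {a c d : ℕ} (ha : 1 ≤ a) (hc : 1 ≤ c) (hn : a + d ≤ n)
    (hac : P a c = false) (hbc : P (a + 1) c = true)
    (hmid : ∀ j, c < j → j < d → P a j = true ∧ P (a + 1) j = true) :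
    ∀ j, c ≤ j → j < d → V a j = N (a + 1 + 1) c ∧ V (a + 1) j = V (a + 1) (c - 1) := by
  intro j hj
  induction j, hj using Nat.le_induction with
  | base =>
    intro hd
    rw [h.bump_east a c ha hc (by omega) hac, h.cross_north _ _ hbc, h.cross_east _ _ hbc]
    exact ⟨rfl, rfl⟩
  | succ j hj ih =>
    intro hd
    obtain ⟨h1, h2⟩ := hmid (j + 1) (by omega) hd
    rw [h.cross_east _ _ h1, h.cross_east _ _ h2]
    exact ih (by omega)

lemma unchute_mem {n : ℕ} {w : Equiv.Perm (Fin n)} (P : RPD w) {a c d : ℕ} (ha : 1 ≤ a)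
    (hc : 1 ≤ c) (hcd : c < d) (hn : a + d ≤ n)
    (hac : P.1 a c = false) (hbc : P.1 (a + 1) c = true)
    (hmid : ∀ j, c < j → j < d → P.1 a j = true ∧ P.1 (a + 1) j = true)
    (had : P.1 a d = false) (hbd : P.1 (a + 1) d = false) :
    IsPD w (unchute P.1 a c d) ∧ Reduced n (unchute P.1 a c d) := by
  obtain ⟨N, V, hL, hw, hR⟩ := P.exists_labeling
  have hP := P.crossesIn
  obtain ⟨P, hPmem⟩ := P
  simp only at *
  have hT : CrossesIn n (unchute P a c d) := fun i j h => by
    unfold unchute at h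
    split_ifs at h with h1 h2
    · omega
    · exact hP i j h
  have hs := hL.two_row_strip ha hc hn hac hbc hmid
  have hVa : ∀ j, c ≤ j → j < d → V a j = N (a + 1 + 1) c := fun j h1 h2 => (hs j h1 h2).1
  have hVb : ∀ j, c ≤ j → j < d → V (a + 1) j = V (a + 1) (c - 1) := fun j h1 h2 => (hs j h1 h2).2
  have hNbd : N (a + 1) d = V (a + 1) (c - 1) := by
    rw [hL.bump_north _ _ (by omega) (by omega) (by omega) hbd, hVb (d - 1) (by omega) (by omega)]
  have hNbc : N (a + 1) c = N (a + 1 + 1) c := hL.cross_north _ _ hbc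
  have hNad : N a d = N (a + 1 + 1) c := by
    rw [hL.bump_north _ _ (by omega) (by omega) (by omega) had, hVa (d - 1) (by omega) (by omega)]
  have hVad : V a d = V (a + 1) (c - 1) := by
    rw [hL.bump_east _ _ (by omega) (by omega) (by omega) had, hNbd]
  obtain ⟨N', hN'⟩ : ∃ N' : ℕ → ℕ → ℕ, ∀ i j, N' i j = if i = a + 1 ∧ j = c then V (a + 1) (c - 1)
    else if i = a + 1 ∧ j = d then N (a + 1 + 1) c else N i j := ⟨_, fun _ _ => rfl⟩
  obtain ⟨V', hV'⟩ : ∃ V' : ℕ → ℕ → ℕ, ∀ i j, V' i j =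
    if i = a ∧ c ≤ j ∧ j < d then V (a + 1) (c - 1)
    else if i = a + 1 ∧ c ≤ j ∧ j < d then N (a + 1 + 1) c else V i j := ⟨_, fun _ _ => rfl⟩
  have hL' : IsLabeling n (unchute P a c d) N' V' := by
    constructor
    · intro i h1 h2
      rw [hV', if_neg (by omega), if_neg (by omega), hL.base i h1 h2]
    · intro i j hb
      have := hL.cross_north i j
      simp only [unchute] at hb
      grind
    · intro i j hb
      have := hL.cross_east i j
      have := hP i j
      simp only [unchute] at hb
      grind
    · intro i j h1 h2 h3 hb
      have := hL.bump_north i j h1 h2 h3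
      have := hmid j
      simp only [unchute] at hb
      grind
    · intro i j h1 h2 h3 hb
      have := hL.bump_east i j h1 h2 h3
      have := hmid j
      simp only [unchute] at hb
      grind
  have hbox : ∀ i j, unchute P a c d i j = true →
      P (unchuteBox a c d i j).1 (unchuteBox a c d i j).2 = true ∧
      V' i (j - 1) = V (unchuteBox a c d i j).1 ((unchuteBox a c d i j).2 - 1) ∧
      N' (i + 1) j = N ((unchuteBox a c d i j).1 + 1) (unchuteBox a c d i j).2 := by
    intro i j hb
    have h1 := hmid j
    have h2 := hT i j hb
    have h3 := hL.cross_north (a + 1) j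
    simp only [unchute] at hb
    simp only [unchuteBox]
    split_ifs
    · grind
    · grind
    · grind
    · grind
  have hinj : ∀ i j i' j', unchute P a c d i j = true → unchute P a c d i' j' = true →
      unchuteBox a c d i j = unchuteBox a c d i' j' → i = i' ∧ j = j' := by
    intro i j i' j' hb hb' h
    simp only [unchute] at hb hb'
    simp only [unchuteBox] at h
    split_ifs at h <;> simp only [Prod.mk.injEq] at h <;> grind
  refine (isPD_and_reduced_iff w hT hL').2 ⟨fun j h1 h2 => ?_, ?_⟩
  · rw [hN', if_neg (by omega), if_neg (by omega), hw j h1 h2]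
  · intro i j i' j' hb hb' hh
    obtain ⟨q1, q2, q3⟩ := hbox i j hb
    obtain ⟨q1', q2', q3'⟩ := hbox i' j' hb'
    rw [q2, q3, q2', q3'] at hh
    have := hR _ _ _ _ q1 q1' hh
    exact hinj i j i' j' hb hb' (Prod.ext this.1 this.2)

lemma chuteStep_unchute {n : ℕ} {P : ℕ → ℕ → Bool} {a c d : ℕ} (ha : 1 ≤ a)
    (hc : 1 ≤ c) (hcd : c < d) (hn : a + d ≤ n)
    (hac : P a c = false) (hbc : P (a + 1) c = true)
    (hmid : ∀ j, c < j → j < d → P a j = true ∧ P (a + 1) j = true)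
    (had : P a d = false) (hbd : P (a + 1) d = false) :
    ChuteStep n (unchute P a c d) P := by
  refine ⟨a, a + 1, c, d, ⟨ha, by omega, hc, hcd, by omega, ?_, ?_, ?_, ?_⟩, ?_⟩
  · rw [unchute, if_neg (by omega), if_neg (by omega), hac]
  · rw [unchute, if_pos (by omega)]
  · rw [unchute, if_neg (by omega), if_neg (by omega), hbd]
  · intro i j h1 h2 h3 h4 h5 h6 h7
    rw [unchute, if_neg h6]
    by_cases h8 : i = a ∧ j = d
    · rw [if_pos h8]
    · rw [if_neg h8]
      have := hmid j (by omega) (by omega)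
      obtain rfl | rfl : i = a ∨ i = a + 1 := by omega
      · exact this.1
      · exact this.2
  · funext i j
    simp only [chuteResult, unchute]
    split_ifs with h1 h2
    · rw [h1.1, h1.2, hbc]
    · rw [h2.1, h2.2, had]
    · rfl

/-- In every column, the crosses form an initial segment. -/
def TopJustified (P : ℕ → ℕ → Bool) : Prop :=
  ∀ i j, 1 ≤ i → P (i + 1) j = true → P i j = true

lemma exists_unchute {n : ℕ} {w : Equiv.Perm (Fin n)} (P : RPD w) (hT : ¬TopJustified P.1) :
    ∃ a c d, 1 ≤ a ∧ 1 ≤ c ∧ c < d ∧ a + d ≤ n ∧ P.1 a c = false ∧ P.1 (a + 1) c = true ∧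
      (∀ j, c < j → j < d → P.1 a j = true ∧ P.1 (a + 1) j = true) ∧
      P.1 a d = false ∧ P.1 (a + 1) d = false := by
  obtain ⟨N, V, hL, -, hR⟩ := P.exists_labeling
  have hP := P.crossesIn
  unfold TopJustified at hT
  push Not at hT
  obtain ⟨a, c₀, ha, hc₀, hc₀'⟩ := hT
  let p : ℕ → Prop := fun j => P.1 (a + 1) j = true ∧ P.1 a j ≠ true
  have hp : p c₀ := ⟨hc₀, hc₀'⟩
  have hbound : ∀ j, p j → j ≤ n := fun j hj => by
    have := hP _ _ hj.1
    omega
  obtain ⟨hbc, hac⟩ : p (Nat.findGreatest p n) := Nat.findGreatest_spec (hbound _ hp) hp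
  have hmax : ∀ j, Nat.findGreatest p n < j → ¬p j := fun j hj hpj =>
    Nat.findGreatest_is_greatest hj (hbound j hpj) hpj
  generalize Nat.findGreatest p n = c at hbc hac hmax
  have hc := hP _ _ hbc
  have hex : ∃ d, c < d ∧ ¬(P.1 a d = true ∧ P.1 (a + 1) d = true) :=
    ⟨n + 1, by omega, fun h => by have := hP _ _ h.1; omega⟩
  obtain ⟨hcd, hd⟩ := Nat.find_spec hex
  have hmin : ∀ j, c < j → j < Nat.find hex → P.1 a j = true ∧ P.1 (a + 1) j = true :=
    fun j h1 h2 => by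
      by_contra h
      exact Nat.find_min hex h2 ⟨h1, h⟩
  generalize Nat.find hex = d at hcd hd hmin
  replace hac : P.1 a c = false := Bool.eq_false_iff.2 hac
  have hdn : a + d ≤ n := by
    by_cases h : d = c + 1
    · omega
    · have := hP _ _ (hmin (d - 1) (by omega) (by omega)).2
      omega
  have hbd : P.1 (a + 1) d = false := by
    rw [← Bool.not_eq_true]
    intro h
    exact hmax d hcd ⟨h, fun h' => hd ⟨h', h⟩⟩
  refine ⟨a, c, d, ha, hc.2.1, hcd, hdn, hac, hbc, hmin, ?_, hbd⟩
  rw [← Bool.not_eq_true]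
  intro had
  have hs := hL.two_row_strip ha hc.2.1 hdn hac hbc hmin (d - 1) (by omega) (by omega)
  have hNbd := hL.bump_north (a + 1) d (by omega) (by omega) (by omega) hbd
  have := hR (a + 1) c a d hbc had (Or.inr ⟨by rw [hNbd, hs.2], by rw [hs.1]⟩)
  omega

lemma exists_topJustified_le {n : ℕ} {w : Equiv.Perm (Fin n)} (P : RPD w) :
    ∃ M : RPD w, TopJustified M.1 ∧ chuteLE w M P := by
  let C : (ℕ → ℕ → Bool) → Finset (ℕ × ℕ) := fun P =>
    (Finset.Icc 1 n ×ˢ Finset.Icc 1 n).filter fun x => P x.1 x.2 = true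
  induction hm : ∑ x ∈ C P.1, x.1 using Nat.strong_induction_on generalizing P with
  | _ m ih =>
    by_cases hT : TopJustified P.1
    · exact ⟨P, hT, Relation.ReflTransGen.refl⟩
    obtain ⟨a, c, d, ha, hc, hcd, hn, hac, hbc, hmid, had, hbd⟩ := exists_unchute P hT
    have hP := P.crossesIn
    let Q : RPD w := ⟨unchute P.1 a c d, unchute_mem P ha hc hcd hn hac hbc hmid had hbd⟩
    have hQ : C Q.1 = insert (a, d) ((C P.1).erase (a + 1, c)) := by
      ext ⟨i, j⟩
      simp only [C, Q, Finset.mem_filter, Finset.mem_product, Finset.mem_Icc,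
        Finset.mem_insert, Finset.mem_erase, Prod.mk.injEq, ne_eq]
      simp only [unchute]
      split_ifs with h1 h2
      · simp only [and_false, false_iff]
        omega
      · simp only [h2]
        simp
        omega
      · simp only [h1, h2]
        simp
    have hmem : (a + 1, c) ∈ C P.1 := by
      have := hP _ _ hbc
      simp only [C, Finset.mem_filter, Finset.mem_product, Finset.mem_Icc]
      exact ⟨⟨⟨by omega, by omega⟩, by omega, by omega⟩, hbc⟩
    have hnot : (a, d) ∉ (C P.1).erase (a + 1, c) := by
      simp [C, had]
    have hlt : ∑ x ∈ C Q.1, x.1 < m := by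
      rw [hQ, Finset.sum_insert hnot, ← hm, ← Finset.add_sum_erase _ _ hmem]
      simp
    obtain ⟨M, hM, hle⟩ := ih _ hlt Q rfl
    exact ⟨M, hM, hle.tail (chuteStep_unchute ha hc hcd hn hac hbc hmid had hbd)⟩

/-- `h j` is the number of crosses in column `j` of the top-justified `P`. -/
def HasHeights (n : ℕ) (P : ℕ → ℕ → Bool) (h : ℕ → ℕ) : Prop :=
  (∀ i j, P i j = true ↔ 1 ≤ i ∧ 1 ≤ j ∧ j ≤ n ∧ i ≤ h j) ∧ ∀ j, 1 ≤ j → j ≤ n → h j + j ≤ n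

lemma TopJustified.exists_heights {n : ℕ} {P : ℕ → ℕ → Bool} (hP : CrossesIn n P)
    (hT : TopJustified P) : ∃ h, HasHeights n P h := by
  refine ⟨fun j => Nat.findGreatest (fun i => P i j = true) n, fun i j => ⟨fun h => ?_, ?_⟩, ?_⟩
  · have := hP i j h
    exact ⟨by omega, by omega, by omega, Nat.le_findGreatest (by omega) h⟩
  · rintro ⟨h1, -, -, h2⟩
    change i ≤ Nat.findGreatest (fun i => P i j = true) n at h2
    have h0 : Nat.findGreatest (fun i => P i j = true) n ≠ 0 := by omega
    have hg : P (Nat.findGreatest (fun i => P i j = true) n) j = true :=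
      Nat.findGreatest_of_ne_zero rfl h0
    exact Nat.decreasingInduction' (P := fun i => P i j = true)
      (fun k _ hk hk' => hT k j (by omega) hk') h2 hg
  · intro j h1 h2
    by_cases h0 : Nat.findGreatest (fun i => P i j = true) n = 0
    · simpa only [h0, zero_add]
    · have hg : P (Nat.findGreatest (fun i => P i j = true) n) j = true :=
        Nat.findGreatest_of_ne_zero rfl h0
      exact (hP _ _ hg).2.2

section Heights

variable {n : ℕ} {P : ℕ → ℕ → Bool} {h : ℕ → ℕ} {N V : ℕ → ℕ → ℕ}

lemma HasHeights.crossesIn (hh : HasHeights n P h) : CrossesIn n P := fun i j hb => by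
  obtain ⟨h1, h2, h3, h4⟩ := (hh.1 i j).1 hb
  have := hh.2 j h2 h3
  omega

lemma HasHeights.bump (hh : HasHeights n P h) {i j : ℕ} (hi : h j < i) : P i j = false := by
  rw [← Bool.not_eq_true, hh.1]
  omega

lemma HasHeights.east_of_le (hh : HasHeights n P h) (hL : IsLabeling n P N V) {i j : ℕ}
    (hi : 1 ≤ i) (hj : 1 ≤ j) (hjn : j ≤ n) (hij : i ≤ h j) : V i j = V i (j - 1) :=
  hL.cross_east i j ((hh.1 i j).2 ⟨hi, hj, hjn, hij⟩)

lemma HasHeights.east_of_lt (hh : HasHeights n P h) (hL : IsLabeling n P N V) {i j : ℕ}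
    (hj : 1 ≤ j) (hn : i + j ≤ n) (hij : h j < i) : V i j = V (i + 1) (j - 1) := by
  rw [hL.bump_east i j (by omega) hj hn (hh.bump hij),
    hL.bump_north (i + 1) j (by omega) hj (by omega) (hh.bump (by omega))]

lemma HasHeights.north_of_le (hh : HasHeights n P h) (hL : IsLabeling n P N V) {i j : ℕ}
    (hi : 1 ≤ i) (hj : 1 ≤ j) (hjn : j ≤ n) (hij : i ≤ h j + 1) :
    N i j = V (h j + 1) (j - 1) := by
  have hn := hh.2 j hj hjn
  refine Nat.decreasingInduction' (P := fun i => N i j = V (h j + 1) (j - 1))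
    (fun k hk hk' ih => ?_) hij ?_
  · rw [hL.cross_north k j ((hh.1 k j).2 ⟨by omega, hj, hjn, by omega⟩), ih]
  · exact hL.bump_north _ _ (by omega) hj (by omega) (hh.bump (by omega))

lemma HasHeights.east_strictMono (hh : HasHeights n P h) (hL : IsLabeling n P N V) :
    ∀ j i i', 1 ≤ i → i < i' → i' + j ≤ n → V i j < V i' j := by
  intro j
  induction j with
  | zero =>
    intro i i' h1 h2 h3
    rwa [hL.base i h1 (by omega), hL.base i' (by omega) (by omega)]
  | succ j ih =>
    intro i i' h1 h2 h3
    by_cases c1 : i ≤ h (j + 1)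
    · rw [hh.east_of_le hL h1 (by omega) (by omega) c1]
      by_cases c2 : i' ≤ h (j + 1)
      · rw [hh.east_of_le hL (by omega) (by omega) (by omega) c2]
        exact ih _ _ h1 h2 (by omega)
      · rw [hh.east_of_lt hL (i := i') (by omega) (by omega) (by omega)]
        exact ih _ _ h1 (by omega) (by omega)
    · rw [hh.east_of_lt hL (i := i) (by omega) (by omega) (by omega),
        hh.east_of_lt hL (i := i') (by omega) (by omega) (by omega)]
      exact ih _ _ (by omega) (by omega) (by omega)

lemma HasHeights.east_injOn (hh : HasHeights n P h) (hL : IsLabeling n P N V) {i i' j : ℕ}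
    (hi : 1 ≤ i) (hi' : 1 ≤ i') (hn : i + j ≤ n) (hn' : i' + j ≤ n) (e : V i j = V i' j) :
    i = i' := by
  rcases lt_trichotomy i i' with hlt | rfl | hlt
  · have := hh.east_strictMono hL j i i' hi hlt hn'
    omega
  · rfl
  · have := hh.east_strictMono hL j i' i hi' hlt hn
    omega

lemma HasHeights.crossesDistinct (hh : HasHeights n P h) (hL : IsLabeling n P N V)
    (hN : ∀ j j', 1 ≤ j → j ≤ n → 1 ≤ j' → j' ≤ n → N 1 j = N 1 j' → j = j') :
    CrossesDistinct P N V := by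
  have key : ∀ i j, P i j = true → N (i + 1) j = N 1 j ∧ V i (j - 1) < N 1 j := fun i j hb => by
    obtain ⟨h1, h2, h3, h4⟩ := (hh.1 i j).1 hb
    have := hh.2 j h2 h3
    rw [hh.north_of_le hL (by omega) h2 h3 (by omega), hh.north_of_le hL le_rfl h2 h3 (by omega)]
    exact ⟨rfl, hh.east_strictMono hL _ _ _ h1 (by omega) (by omega)⟩
  intro i j i' j' hb hb' e
  have h1 := hh.crossesIn i j hb
  have h2 := hh.crossesIn i' j' hb'
  obtain ⟨k1, k2⟩ := key i j hb
  obtain ⟨k1', k2'⟩ := key i' j' hb'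
  have hj : j = j' := hN j j' (by omega) (by omega) (by omega) (by omega) (by omega)
  subst hj
  exact ⟨hh.east_injOn hL (j := j - 1) h1.1 h2.1 (by omega) (by omega) (by omega), rfl⟩

end Heights

lemma HasHeights.eq_of_north_eq {n : ℕ} {P P' : ℕ → ℕ → Bool} {h h' : ℕ → ℕ}
    {N V N' V' : ℕ → ℕ → ℕ} (hh : HasHeights n P h) (hh' : HasHeights n P' h')
    (hL : IsLabeling n P N V) (hL' : IsLabeling n P' N' V')
    (e : ∀ j, 1 ≤ j → j ≤ n → N 1 j = N' 1 j) : P = P' := by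
  have hV : ∀ j, (∀ i, 1 ≤ i → i + j ≤ n → V i j = V' i j) → j < n → h (j + 1) = h' (j + 1) := by
    intro j hj hjn
    have e1 := e (j + 1) (by omega) (by omega)
    have b1 := hh.2 (j + 1) (by omega) (by omega)
    have b2 := hh'.2 (j + 1) (by omega) (by omega)
    rw [hh.north_of_le hL le_rfl (by omega) (by omega) (by omega),
      hh'.north_of_le hL' le_rfl (by omega) (by omega) (by omega), Nat.add_sub_cancel,
      ← hj _ (by omega) (by omega)] at e1
    have := hh.east_injOn hL (by omega) (by omega) (by omega) (by omega) e1
    omega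
  have H : ∀ j i, 1 ≤ i → i + j ≤ n → V i j = V' i j := by
    intro j
    induction j with
    | zero =>
      intro i h1 h2
      rw [hL.base i h1 h2, hL'.base i h1 h2]
    | succ j ih =>
      intro i h1 h2
      have hj := hV j ih (by omega)
      by_cases c : i ≤ h (j + 1)
      · rw [hh.east_of_le hL h1 (by omega) (by omega) c,
          hh'.east_of_le hL' h1 (by omega) (by omega) (by omega)]
        exact ih i h1 (by omega)
      · rw [hh.east_of_lt hL (by omega) h2 (by omega),
          hh'.east_of_lt hL' (by omega) h2 (by omega)]
        exact ih (i + 1) (by omega) (by omega)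
  have hheight : ∀ j, 1 ≤ j → j ≤ n → h j = h' j := fun j h1 h2 => by
    have := hV (j - 1) (H (j - 1)) (by omega)
    rwa [Nat.sub_add_cancel h1] at this
  funext i j
  rw [Bool.eq_iff_iff, hh.1, hh'.1]
  constructor
  · rintro ⟨h1, h2, h3, h4⟩
    exact ⟨h1, h2, h3, by rwa [← hheight j h2 h3]⟩
  · rintro ⟨h1, h2, h3, h4⟩
    exact ⟨h1, h2, h3, by rwa [hheight j h2 h3]⟩

lemma topJustified_unique {n : ℕ} {w : Equiv.Perm (Fin n)} {P Q : RPD w}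
    (hP : TopJustified P.1) (hQ : TopJustified Q.1) : P = Q := by
  obtain ⟨h, hh⟩ := hP.exists_heights P.crossesIn
  obtain ⟨h', hh'⟩ := hQ.exists_heights Q.crossesIn
  obtain ⟨N, V, hL, hw, -⟩ := P.exists_labeling
  obtain ⟨N', V', hL', hw', -⟩ := Q.exists_labeling
  exact Subtype.ext (hh.eq_of_north_eq hh' hL hL' fun j h1 h2 => by rw [hw j h1 h2, hw' j h1 h2])

/-- The values of `w` at positions after `j` that are less than `x`. -/
def laterSmaller {n : ℕ} (w : Equiv.Perm (Fin n)) (j x : ℕ) : Finset ℕ :=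
  (Finset.Ioc j n).filter fun k => permVal w k < x

lemma card_laterSmaller_lt {n : ℕ} (w : Equiv.Perm (Fin n)) {j k x : ℕ} (hjk : j < k)
    (hkn : k ≤ n) (hk : permVal w k < x) :
    (laterSmaller w j (permVal w k)).card < (laterSmaller w j x).card := by
  refine Finset.card_lt_card ⟨fun l hl => ?_, fun hs => ?_⟩
  · simp only [laterSmaller, Finset.mem_filter] at hl ⊢
    exact ⟨hl.1, by omega⟩
  · have : k ∈ laterSmaller w j x := by simp [laterSmaller, hjk, hkn, hk]
    simpa [laterSmaller] using hs this

lemma card_laterSmaller_succ {n : ℕ} (w : Equiv.Perm (Fin n)) {j : ℕ} (hj : j < n) (x : ℕ) :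
    (laterSmaller w j x).card =
      (laterSmaller w (j + 1) x).card + if permVal w (j + 1) < x then 1 else 0 := by
  have : Finset.Ioc j n = insert (j + 1) (Finset.Ioc (j + 1) n) := by
    ext k
    simp only [Finset.mem_Ioc, Finset.mem_insert]
    omega
  unfold laterSmaller
  rw [this, Finset.filter_insert]
  split_ifs
  · rw [Finset.card_insert_of_notMem (by simp)]
  · rfl

lemma card_laterSmaller_le {n : ℕ} (w : Equiv.Perm (Fin n)) {j : ℕ} (x : ℕ) :
    (laterSmaller w j x).card ≤ n - j := by
  simpa [laterSmaller] using Finset.card_filter_le (Finset.Ioc j n) (fun k => permVal w k < x)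

lemma card_laterSmaller_zero {n : ℕ} (w : Equiv.Perm (Fin n)) {x : ℕ} (hx : x ≤ n + 1) :
    (laterSmaller w 0 x).card = x - 1 := by
  have : (laterSmaller w 0 x).image (permVal w) = Finset.Ico 1 x := by
    ext y
    simp only [laterSmaller, Finset.mem_image, Finset.mem_filter, Finset.mem_Ioc, Finset.mem_Ico]
    constructor
    · rintro ⟨k, ⟨⟨h1, h2⟩, h3⟩, rfl⟩
      exact ⟨(permVal_mem w h1 h2).1, h3⟩
    · rintro ⟨h1, h2⟩
      have hy := permVal_mem w.symm h1 (show y ≤ n by omega)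
      have := permVal_symm_permVal w.symm h1 (show y ≤ n by omega)
      rw [Equiv.symm_symm] at this
      exact ⟨permVal w.symm y, ⟨⟨by omega, hy.2⟩, by omega⟩, this⟩
  rw [← Finset.card_image_of_injOn (f := permVal w), this, Nat.card_Ico]
  intro k hk l hl e
  simp only [laterSmaller, Finset.coe_filter, Finset.mem_Ioc, Set.mem_ofPred_eq] at hk hl
  exact permVal_injOn w (by omega) hk.1.2 (by omega) hl.1.2 e

lemma nonempty_RPD {n : ℕ} (w : Equiv.Perm (Fin n)) : Nonempty (RPD w) := by
  let h : ℕ → ℕ := fun j => (laterSmaller w j (permVal w j)).card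
  let P : ℕ → ℕ → Bool := fun i j => decide (1 ≤ i ∧ 1 ≤ j ∧ j ≤ n ∧ i ≤ h j)
  have hh : HasHeights n P h := by
    refine ⟨fun i j => by simp [P], fun j h1 h2 => ?_⟩
    have : h j ≤ n - j := card_laterSmaller_le w _
    omega
  have hL := isLabeling_labels hh.crossesIn
  have hrow : ∀ j, j ≤ n → ∀ k, j < k → k ≤ n →
      eastLabel n P ((laterSmaller w j (permVal w k)).card + 1) j = permVal w k := by
    intro j
    induction j with
    | zero =>
      intro _ k h1 h2
      have := permVal_mem w h1 h2
      rw [card_laterSmaller_zero w (by omega), hL.base _ (by omega) (by omega)]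
      omega
    | succ j ih =>
      intro hj k h1 h2
      have e := ih (by omega) k (by omega) h2
      rw [card_laterSmaller_succ w (by omega)] at e
      have hk := permVal_mem w (j := k) (by omega) h2
      have hb := card_laterSmaller_lt w (x := n + 1) h1 h2 (by omega)
      have hb' := card_laterSmaller_le w (j := j + 1) (n + 1)
      rcases lt_trichotomy (permVal w k) (permVal w (j + 1)) with hlt | heq | hlt
      · have := card_laterSmaller_lt w h1 h2 hlt
        rw [hh.east_of_le hL (by omega) (by omega) hj this]
        rwa [if_neg (by omega)] at e
      · have := permVal_injOn w (by omega) h2 (by omega) hj heq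
        omega
      · have hle : h (j + 1) ≤ (laterSmaller w (j + 1) (permVal w k)).card := by
          refine Finset.card_le_card fun l hl => ?_
          simp only [laterSmaller, Finset.mem_filter] at hl ⊢
          exact ⟨hl.1, by omega⟩
        rw [hh.east_of_lt hL (by omega) (by omega) (by omega)]
        rwa [if_pos hlt] at e
  have hw : ∀ j, 1 ≤ j → j ≤ n → northLabel n P 1 j = permVal w j := by
    intro j h1 h2
    have e := hrow (j - 1) (by omega) j (by omega) h2
    rw [card_laterSmaller_succ w (by omega), Nat.sub_add_cancel h1, if_neg (lt_irrefl _)] at e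
    rw [hh.north_of_le hL le_rfl h1 h2 (by omega)]
    exact e
  refine ⟨P, (isPD_and_reduced_iff w hh.crossesIn hL).2 ⟨hw, hh.crossesDistinct hL ?_⟩⟩
  intro j j' h1 h2 h1' h2' e
  rw [hw j h1 h2, hw j' h1' h2'] at e
  exact permVal_injOn w h1 h2 h1' h2' e

lemma exists_chute_min {n : ℕ} (w : Equiv.Perm (Fin n)) : ∃ M : RPD w, ∀ P, chuteLE w M P := by
  obtain ⟨P₀⟩ := nonempty_RPD w
  obtain ⟨M, hM, -⟩ := exists_topJustified_le P₀
  refine ⟨M, fun P => ?_⟩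
  obtain ⟨M', hM', hle⟩ := exists_topJustified_le P
  rwa [topJustified_unique hM hM']

lemma chuteStep_transposePD {n : ℕ} {P Q : ℕ → ℕ → Bool} (h : ChuteStep n P Q) :
    ChuteStep n (transposePD Q) (transposePD P) := by
  obtain ⟨a, b, c, d, ⟨h1, h2, h3, h4, h5, h6, h7, h8, h9⟩, rfl⟩ := h
  refine ⟨c, d, a, b, ⟨h3, h4, h1, h2, by omega, ?_, ?_, ?_, ?_⟩, ?_⟩
  · rw [transposePD, chuteResult, if_neg (by omega), if_neg (by omega), h6]
  · rw [transposePD, chuteResult, if_neg (by omega), if_pos (by omega)]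
  · rw [transposePD, chuteResult, if_neg (by omega), if_neg (by omega), h8]
  · intro i j q1 q2 q3 q4 q5 q6 q7
    rw [transposePD, chuteResult]
    split_ifs with c1 c2
    · rfl
    · omega
    · exact h9 j i q3 q4 q1 q2 (by omega) (by omega) (by omega)
  · funext i j
    simp only [transposePD, chuteResult]
    split_ifs with c1 c2 c3 c4
    · rw [c1.1, c1.2]
      exact h9 a d (by omega) (by omega) (by omega) (by omega) (by omega) (by omega) (by omega)
    · rw [c2.1, c2.2, h7]
    · omega
    · omega
    · rfl

lemma exists_chute_max {n : ℕ} (w : Equiv.Perm (Fin n)) : ∃ M : RPD w, ∀ P, chuteLE w P M := by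
  obtain ⟨M, hM⟩ := exists_chute_min w.symm
  let t : RPD w → RPD w.symm := fun P => ⟨transposePD P.1, transposePD_mem P⟩
  let t' : RPD w.symm → RPD w := fun P => ⟨transposePD P.1, transposePD_mem P⟩
  refine ⟨t' M, fun P => ?_⟩
  have := Relation.ReflTransGen.lift (p := fun X Y : RPD w => ChuteStep n Y.1 X.1) t'
    (fun X Y hXY => chuteStep_transposePD hXY) _ _ (hM (t P))
  exact Relation.ReflTransGen.swap _ _ this

lemma exists_triPD_of_chuteLE {n : ℕ} {w : Equiv.Perm (Fin n)} {wtri : Equiv.Perm (Fin (2 * n))}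
    (hwtri : ∀ i, 1 ≤ i → i ≤ 2 * n →
      permVal wtri i = if i ≤ n then i else 2 * n + 1 - permVal w (2 * n + 1 - i))
    (P : RPD w) (α γ : RPD wtri) (hα : α.1 = triPD n P.1) (hle : chuteLE wtri α γ)
    (hγ : ∀ i j, γ.1 i j = true → i ≤ n) :
    ∃ Q : RPD w, triPD n Q.1 = γ.1 ∧ chuteLE w P Q := by
  induction hle with
  | refl => exact ⟨P, hα.symm, Relation.ReflTransGen.refl⟩
  | @tail β γ hβ hstep ih =>
    obtain ⟨Q, hQ, hPQ⟩ := ih (hstep.rows_le hγ)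
    rw [← hQ] at hstep
    obtain ⟨R, hR, hRγ, hQR⟩ := exists_chuteStep_of_triPD Q.crossesIn hstep hγ
    have hmem := γ.2
    rw [← hRγ] at hmem
    exact ⟨⟨R, (triPD_mem_iff w wtri hwtri hR).1 hmem⟩, hRγ, hPQ.tail hQR⟩

lemma rows_le_of_chuteLE {n : ℕ} {m : ℕ} {w : Equiv.Perm (Fin m)} {γ β : RPD w}
    (hle : chuteLE w γ β) (hβ : ∀ i j, β.1 i j = true → i ≤ n) :
    ∀ i j, γ.1 i j = true → i ≤ n := by
  induction hle using Relation.ReflTransGen.head_induction_on with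
  | refl => exact hβ
  | head h _ ih => exact h.rows_le ih

/-- the triforce embedding `P ↦ P^∇` is a poset isomorphism from
`PD(w)` onto an interval of `PD(w^∇)`, where `w^∇ ∈ S_{2n}` is defined by
`w^∇(i) = i` for `1 ≤ i ≤ n` and `w^∇(i) = 2n+1−w(2n+1−i)` for `n+1 ≤ i ≤ 2n`. -/
theorem triforce_embedding {n : ℕ} (w : Equiv.Perm (Fin n))
    (wtri : Equiv.Perm (Fin (2 * n)))
    (hwtri : ∀ i, 1 ≤ i → i ≤ 2 * n →
      permVal wtri i = if i ≤ n then i else 2 * n + 1 - permVal w (2 * n + 1 - i)) :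
    ∃ t : RPD w → RPD wtri,
      (∀ P : RPD w, (t P).1 = triPD n P.1) ∧
      Function.Injective t ∧
      (∀ P Q : RPD w, chuteLE w P Q ↔ chuteLE wtri (t P) (t Q)) ∧
      ∃ α β : RPD wtri,
        Set.range t = { γ | chuteLE wtri α γ ∧ chuteLE wtri γ β } := by
  let t : RPD w → RPD wtri := fun P =>
    ⟨triPD n P.1, (triPD_mem_iff w wtri hwtri P.crossesIn).2 P.2⟩
  have hinj : Function.Injective t := fun P Q h =>
    Subtype.ext (triPD_injective P.crossesIn Q.crossesIn (congrArg Subtype.val h))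
  have hrows : ∀ P : RPD w, ∀ i j, (t P).1 i j = true → i ≤ n := fun P i j h =>
    ((triPD_eq_true P.crossesIn).1 h).1
  have hmono : ∀ P Q : RPD w, chuteLE w P Q → chuteLE wtri (t P) (t Q) := fun P Q h =>
    Relation.ReflTransGen.lift t (fun X Y hXY => chuteStep_triPD hXY) _ _ h
  have hlift : ∀ (P : RPD w) (γ : RPD wtri), chuteLE wtri (t P) γ →
      (∀ i j, γ.1 i j = true → i ≤ n) → ∃ Q, t Q = γ ∧ chuteLE w P Q := fun P γ h hγ => by
    obtain ⟨Q, hQ, hPQ⟩ := exists_triPD_of_chuteLE hwtri P (t P) γ rfl h hγ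
    exact ⟨Q, Subtype.ext hQ, hPQ⟩
  refine ⟨t, fun _ => rfl, hinj, fun P Q => ⟨hmono P Q, fun h => ?_⟩, ?_⟩
  · obtain ⟨R, hR, hPR⟩ := hlift P (t Q) h (hrows Q)
    rwa [← hinj hR]
  · obtain ⟨α, hα⟩ := exists_chute_min w
    obtain ⟨β, hβ⟩ := exists_chute_max w
    refine ⟨t α, t β, Set.ext fun γ => ⟨?_, ?_⟩⟩
    · rintro ⟨P, rfl⟩
      exact ⟨hmono _ _ (hα P), hmono _ _ (hβ P)⟩
    · rintro ⟨h1, h2⟩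
      obtain ⟨Q, hQ, -⟩ := hlift α γ h1 (rows_le_of_chuteLE h2 (hrows β))
      exact ⟨Q, hQ⟩
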